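/- Let k be a field of characteristic zero, let f ∈ k[x] be squarefree, let ℓ ≥ 2 be an integer, and let a ∈ k[x]. Then there exist polynomials U, V ∈ k[x] such that a = U·f + f·V′ − (ℓ−1)·V·f′. (This polynomial identity encodes the Hermite reduction step a/f^ℓ = U/f^{ℓ−1} + d/dx(V/f^{ℓ−1}) in k(x), lowering the order of the pole along f.) -/

import Mathlib

open Polynomial

/-- Hermite reduction step: for `f` squarefree, `ℓ ≥ 2` and any `a`, there are `U, V`
with `a = U·f + f·V′ − (ℓ−1)·V·f′`, encoding `a/f^ℓ = U/f^{ℓ−1} + (−V/((ℓ−1)f^{ℓ−1}))′`. -/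
theorem hermite_reduction_step {k : Type*} [Field k] [CharZero k]
    (f : k[X]) (hf : IsCoprime f (derivative f))
    (ℓ : ℕ) (hℓ : 2 ≤ ℓ) (a : k[X]) :
    ∃ U V : k[X],
      a = U * f + f * derivative V - ((ℓ - 1 : ℕ) : k[X]) * V * derivative f := by
  obtain ⟨u, v, huv⟩ := hf
  have hne : ((ℓ - 1 : ℕ) : k) ≠ 0 := Nat.cast_ne_zero.mpr (by omega)
  have hinv : ((ℓ - 1 : ℕ) : k[X]) * C (((ℓ - 1 : ℕ) : k)⁻¹) = 1 := by
    rw [← C_eq_natCast, ← C_mul, mul_inv_cancel₀ hne, C_1]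
  refine ⟨a * u - derivative (-(C (((ℓ - 1 : ℕ) : k)⁻¹) * a * v)),
    -(C (((ℓ - 1 : ℕ) : k)⁻¹) * a * v), ?_⟩
  linear_combination (-a) * huv - a * v * derivative f * hinv
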